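/- arXiv:1905.03186 — 2 statements merged into one kernel-verified Lean document; each statement's English description precedes it below -/
import Mathlib

section
/- Let ε ≠ 0 and define p̄ : (−1,∞) → ℝ by p̄(R) = (1+R)^{−2} · exp((2/ε²)(ln(1+R) − R)). Then for every R > −1 the identity (d/dR)[R(1+R)·p̄(R)] + (ε²/2)·(d²/dR²)[(1+R)²·p̄(R)] = 0 holds; that is, p̄ is a stationary solution of the Fokker–Planck equation ∂p/∂t = −∂/∂R[−R(1+R)p] + (ε²/2)∂²/∂R²[(1+R)²p]. -/
open Filter Topology in
/-- The zero-flux identity: the diffusive flux of the density balances its drift flux. -/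
theorem deriv_sq_mul_stationaryDensity (ε : ℝ) (p : ℝ → ℝ)
    (hp : ∀ R : ℝ, p R = ((1 + R) ^ 2)⁻¹ * Real.exp ((2 / ε ^ 2) * (Real.log (1 + R) - R)))
    {R : ℝ} (hR : -1 < R) :
    deriv (fun R => (1 + R) ^ 2 * p R) R = -(2 / ε ^ 2) * (R * (1 + R) * p R) := by
  have h_ne : 1 + R ≠ 0 := by linarith
  have h_eq : (fun R => (1 + R) ^ 2 * p R) =ᶠ[𝓝 R]
      fun R => Real.exp ((2 / ε ^ 2) * (Real.log (1 + R) - R)) := by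
    filter_upwards [Ioi_mem_nhds hR] with S hS
    have hS' : 1 + S ≠ 0 := by linarith [Set.mem_Ioi.mp hS]
    rw [hp, mul_inv_cancel_left₀ (pow_ne_zero 2 hS')]
  have h_deriv := (((((hasDerivAt_id' R).const_add 1).log h_ne).sub
    (hasDerivAt_id' R)).const_mul (2 / ε ^ 2)).exp
  rw [h_eq.deriv_eq]
  refine h_deriv.deriv.trans ?_
  rw [hp]
  simp only [Pi.sub_apply]
  generalize 2 / ε ^ 2 = c
  field_simp
  ring


/-- For `ε ≠ 0`, the function
`p̄(R) = (1+R)⁻² exp((2/ε²)(ln(1+R) − R))` satisfies, at every `R > −1`,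
`(d/dR)[R(1+R)p̄(R)] + (ε²/2)(d²/dR²)[(1+R)²p̄(R)] = 0`, i.e. it is a stationary solution
of the Fokker–Planck equation `∂p/∂t = −∂/∂R[−R(1+R)p] + (ε²/2)∂²/∂R²[(1+R)²p]`. -/
theorem stmt11 (ε : ℝ) (hε : ε ≠ 0) (pbar : ℝ → ℝ)
    (hp : ∀ R : ℝ, pbar R = ((1 + R) ^ 2)⁻¹ * Real.exp ((2 / ε ^ 2) * (Real.log (1 + R) - R))) :
    ∀ R : ℝ, -1 < R →
      deriv (fun R => R * (1 + R) * pbar R) R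
        + ε ^ 2 / 2 * deriv (deriv (fun R => (1 + R) ^ 2 * pbar R)) R = 0 := by
  intro R hR
  have h_eq : deriv (fun R => (1 + R) ^ 2 * pbar R) =ᶠ[nhds R]
      fun R => -(2 / ε ^ 2) * (R * (1 + R) * pbar R) := by
    filter_upwards [Ioi_mem_nhds hR] with S hS
    exact deriv_sq_mul_stationaryDensity ε pbar hp hS
  rw [h_eq.deriv_eq, deriv_const_mul_field]
  field_simp
  ring
end

section
/- Let 0 < ε < √2 and define p̄ : (−1,∞) → ℝ by p̄(R) = (1+R)^{−2} · exp((2/ε²)(ln(1+R) − R)). Then the function R ↦ R·p̄(R) is Lebesgue integrable on (−1,∞) and ∫_{−1}^{∞} R·p̄(R) dR = −(ε²/2) · ∫_{−1}^{∞} p̄(R) dR. Equivalently, the mean of the normalized stationary amplitude distribution is E[R] = −ε²/2. -/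
open MeasureTheory Set

lemma inv_sq_mul_exp_mul_log_sub {a x : ℝ} (hx : 0 < x) :
    (x ^ 2)⁻¹ * Real.exp (a * (Real.log x - (x - 1))) =
      Real.exp a * (x ^ ((a - 1) - 1) * Real.exp (-(a * x))) := by
  rw [show (a - 1) - 1 = a - (2 : ℕ) by push_cast; ring, Real.rpow_sub hx, Real.rpow_natCast,
    Real.rpow_def_of_pos hx a,
    show a * (Real.log x - (x - 1)) = a + (Real.log x * a + -(a * x)) by ring,
    Real.exp_add, Real.exp_add]
  ring

lemma integrableOn_rpow_sub_one_mul_exp_neg_mul {s a : ℝ} (hs : 0 < s) (ha : 0 < a) :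
    IntegrableOn (fun x : ℝ => x ^ (s - 1) * Real.exp (-(a * x))) (Ioi 0) := by
  simpa using integrableOn_rpow_mul_exp_neg_mul_rpow (by linarith : -1 < s - 1) one_pos ha

lemma integral_rpow_mul_exp_neg_mul_eq {a : ℝ} (ha : 1 < a) :
    ∫ x in Ioi (0 : ℝ), x ^ (a - 1) * Real.exp (-(a * x)) =
      (1 - 1 / a) * ∫ x in Ioi (0 : ℝ), x ^ ((a - 1) - 1) * Real.exp (-(a * x)) := by
  have ha0 : 0 < a := by linarith
  have hΓ := Real.Gamma_add_one (sub_ne_zero.2 ha.ne')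
  have hpow := Real.rpow_add_one (one_div_pos.2 ha0).ne' (a - 1)
  rw [sub_add_cancel] at hΓ hpow
  rw [Real.integral_rpow_mul_exp_neg_mul_Ioi ha0 ha0,
    Real.integral_rpow_mul_exp_neg_mul_Ioi (sub_pos.2 ha) ha0, hΓ, hpow]
  field_simp

/-- For `0 < ε < √2` and
`p̄(R) = (1+R)⁻² exp((2/ε²)(ln(1+R) − R))` on `(−1,∞)`, the function `R ↦ R·p̄(R)` is
integrable on `(−1,∞)` and `∫ R p̄(R) dR = −(ε²/2) ∫ p̄(R) dR`; i.e. the mean of the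
normalized stationary amplitude distribution is `E[R] = −ε²/2`. -/
theorem stmt13 (ε : ℝ) (hε : 0 < ε) (hε2 : ε < Real.sqrt 2) (pbar : ℝ → ℝ)
    (hp : ∀ R : ℝ, pbar R = ((1 + R) ^ 2)⁻¹ * Real.exp ((2 / ε ^ 2) * (Real.log (1 + R) - R))) :
    IntegrableOn (fun R => R * pbar R) (Ioi (-1 : ℝ)) ∧
    ∫ R in Ioi (-1 : ℝ), R * pbar R = -(ε ^ 2 / 2) * ∫ R in Ioi (-1 : ℝ), pbar R := by
  set a := 2 / ε ^ 2 with ha_def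
  have ha : 1 < a := by
    rw [ha_def, one_lt_div (by positivity)]
    exact (Real.lt_sqrt hε.le).1 hε2
  have ha0 : 0 < a := by linarith
  have hεa : ε ^ 2 / 2 = 1 / a := by rw [ha_def, one_div_div]
  set f : ℝ → ℝ := fun x => x ^ (a - 1) * Real.exp (-(a * x)) with hf_def
  set g : ℝ → ℝ := fun x => x ^ ((a - 1) - 1) * Real.exp (-(a * x)) with hg_def
  have hf : IntegrableOn f (Ioi 0) := integrableOn_rpow_sub_one_mul_exp_neg_mul ha0 ha0
  have hg : IntegrableOn g (Ioi 0) := integrableOn_rpow_sub_one_mul_exp_neg_mul (sub_pos.2 ha) ha0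
  have hfg : ∫ x in Ioi (0 : ℝ), f x = (1 - 1 / a) * ∫ x in Ioi (0 : ℝ), g x :=
    integral_rpow_mul_exp_neg_mul_eq ha
  have hpre : (fun R : ℝ => 1 + R) ⁻¹' Ioi 0 = Ioi (-1) := by
    ext R
    simp only [mem_preimage, mem_Ioi]
    constructor <;> intro h <;> linarith
  have hmp := measurePreserving_add_left (volume : Measure ℝ) 1
  have hemb := measurableEmbedding_addLeft (1 : ℝ)
  have hpg : EqOn pbar (fun R => Real.exp a * g (1 + R)) (Ioi (-1)) := by
    intro R hR
    have hx : 0 < 1 + R := by linarith [mem_Ioi.1 hR]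
    have h := inv_sq_mul_exp_mul_log_sub (a := a) hx
    rw [add_sub_cancel_left] at h
    rw [hp, h]
  have hpf : EqOn (fun R => R * pbar R) (fun R => Real.exp a * (f (1 + R) - g (1 + R)))
      (Ioi (-1)) := by
    intro R hR
    have hx : 0 < 1 + R := by linarith [mem_Ioi.1 hR]
    have hfx : f (1 + R) = (1 + R) * g (1 + R) := by
      simp only [hf_def, hg_def]
      rw [Real.rpow_sub_one hx.ne' (a - 1)]
      field_simp
    simp only [hpg hR, hfx]
    ring
  have hF : IntegrableOn (fun x => Real.exp a * (f x - g x)) (Ioi 0) :=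
    (hf.sub hg).const_mul _
  constructor
  · rw [integrableOn_congr_fun hpf measurableSet_Ioi, ← hpre]
    exact (hmp.integrableOn_comp_preimage hemb).2 hF
  · rw [setIntegral_congr_fun measurableSet_Ioi hpf, setIntegral_congr_fun measurableSet_Ioi hpg,
      ← hpre, hmp.setIntegral_preimage_emb hemb (fun x => Real.exp a * (f x - g x)),
      hmp.setIntegral_preimage_emb hemb (fun x => Real.exp a * g x), integral_const_mul,
      integral_const_mul, integral_sub hf hg, hfg, hεa]
    ring
end
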